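/- The following identity of formal power series in u^{−1} with coefficients in U holds: ∂_u cdet(u + τ + E[−1]) = cdet(u + τ + E[−1]) · Σ_{k=0}^{∞} (−1)^k u^{−k−1} tr((τ + E[−1])^k), where u is a central formal variable, cdet(u + τ + E[−1]) is a polynomial in u of degree n with coefficients in U, ∂_u is differentiation with respect to u, and the identity is an equality in the ring U[u][[u^{−1}]] of formal series. -/

import Mathlib

open scoped BigOperators

/-- Generators of the Lie algebra `L`: the elements `e_{ij}[r]`, the central
element `K` and the element `τ`. -/
inductive AffGen (n : ℕ) : Type
  | E : Fin n → Fin n → ℤ → AffGen n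
  | K : AffGen n
  | T : AffGen n

/-- The defining relations of the universal enveloping algebra `U(L)`:
`K` is central, `[τ, e_{ij}[r]] = -r e_{ij}[r-1]`, `[τ, K] = 0`, and
`[e_{ij}[r], e_{kl}[s]] = δ_{kj} e_{il}[r+s] - δ_{il} e_{kj}[r+s]
  + r δ_{r,-s} (δ_{kj} δ_{il} - δ_{ij} δ_{kl}/n) K`. -/
inductive AffRel (n : ℕ) :
    FreeAlgebra ℂ (AffGen n) → FreeAlgebra ℂ (AffGen n) → Prop
  | KE (i j : Fin n) (r : ℤ) :
      AffRel n (FreeAlgebra.ι ℂ (AffGen.K : AffGen n) * FreeAlgebra.ι ℂ (AffGen.E i j r))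
            (FreeAlgebra.ι ℂ (AffGen.E i j r) * FreeAlgebra.ι ℂ (AffGen.K : AffGen n))
  | KT :
      AffRel n (FreeAlgebra.ι ℂ (AffGen.K : AffGen n) * FreeAlgebra.ι ℂ (AffGen.T : AffGen n))
            (FreeAlgebra.ι ℂ (AffGen.T : AffGen n) * FreeAlgebra.ι ℂ (AffGen.K : AffGen n))
  | TE (i j : Fin n) (r : ℤ) :
      AffRel n (FreeAlgebra.ι ℂ (AffGen.T : AffGen n) * FreeAlgebra.ι ℂ (AffGen.E i j r)
              - FreeAlgebra.ι ℂ (AffGen.E i j r) * FreeAlgebra.ι ℂ (AffGen.T : AffGen n))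
            ((-r : ℂ) • FreeAlgebra.ι ℂ (AffGen.E i j (r - 1)))
  | EE (i j k l : Fin n) (r s : ℤ) :
      AffRel n (FreeAlgebra.ι ℂ (AffGen.E i j r) * FreeAlgebra.ι ℂ (AffGen.E k l s)
              - FreeAlgebra.ι ℂ (AffGen.E k l s) * FreeAlgebra.ι ℂ (AffGen.E i j r))
            ((if k = j then FreeAlgebra.ι ℂ (AffGen.E i l (r + s)) else 0)
              - (if i = l then FreeAlgebra.ι ℂ (AffGen.E k j (r + s)) else 0)
              + (((r : ℂ) * (if r = -s then (1 : ℂ) else 0) *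
                    ((if k = j then (1 : ℂ) else 0) * (if i = l then (1 : ℂ) else 0)
                      - (if i = j then (1 : ℂ) else 0) * (if k = l then (1 : ℂ) else 0)
                          / (n : ℂ))) •
                  FreeAlgebra.ι ℂ (AffGen.K : AffGen n)))

/-- The universal enveloping algebra `U = U(L)`. -/
abbrev UEA (n : ℕ) : Type := RingQuot (AffRel n)

/-- The element `e_{ij}[r]` of `U`. -/
noncomputable def eGen (n : ℕ) (i j : Fin n) (r : ℤ) : UEA n :=
  RingQuot.mkAlgHom ℂ (AffRel n) (FreeAlgebra.ι ℂ (AffGen.E i j r))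

/-- The central element `K` of `U`. -/
noncomputable def KGen (n : ℕ) : UEA n :=
  RingQuot.mkAlgHom ℂ (AffRel n) (FreeAlgebra.ι ℂ (AffGen.K : AffGen n))

/-- The element `τ` of `U`. -/
noncomputable def tauGen (n : ℕ) : UEA n :=
  RingQuot.mkAlgHom ℂ (AffRel n) (FreeAlgebra.ι ℂ (AffGen.T : AffGen n))

/-- The column-determinant of a matrix over a (noncommutative) ring:
`cdet A = Σ_σ sgn σ · a_{σ(1)1} a_{σ(2)2} ⋯ a_{σ(n)n}`, factors ordered by
column index. -/
noncomputable def cdet {R : Type*} [Ring R] {n : ℕ} (A : Matrix (Fin n) (Fin n) R) : R :=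
  ∑ σ : Equiv.Perm (Fin n),
    (Equiv.Perm.sign σ : ℤ) • (List.ofFn fun j : Fin n => A (σ j) j).prod

/-- The matrix `τ + E[-1]`, with `(i,j)` entry `δ_{ij} τ + e_{ij}[-1]`. -/
noncomputable def tauE (n : ℕ) : Matrix (Fin n) (Fin n) (UEA n) :=
  Matrix.of fun i j => (if i = j then tauGen n else 0) + eGen n i j (-1)

/-- The subalgebra `U(g₋)` of `U` generated by the `e_{ij}[r]` with `r < 0`. -/
noncomputable def Uneg (n : ℕ) : Subalgebra ℂ (UEA n) :=
  Algebra.adjoin ℂ {x : UEA n | ∃ i j : Fin n, ∃ r : ℤ, r < 0 ∧ x = eGen n i j r}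

/-- The left ideal `I` of `U` generated by the `e_{ij}[r]` with `r ≥ 0`. -/
noncomputable def Ipos (n : ℕ) : Submodule (UEA n) (UEA n) :=
  Submodule.span (UEA n)
    {x : UEA n | ∃ i j : Fin n, ∃ r : ℤ, 0 ≤ r ∧ x = eGen n i j r}

/-- The left submodule `(K + n)·U + I` of `U` (note `K + n` is central,
so `(K+n)·U = U·(K+n)`). -/
noncomputable def KnI (n : ℕ) : Submodule (UEA n) (UEA n) :=
  Submodule.span (UEA n)
    (insert (KGen n + (n : UEA n))
      {x : UEA n | ∃ i j : Fin n, ∃ r : ℤ, 0 ≤ r ∧ x = eGen n i j r})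

/-- The column-determinant `cdet(u + τ + E[-1])`, a polynomial in the central
variable `u` of degree `n` with coefficients in `U`; the `(i,j)` entry of the
matrix is `δ_{ij}(u + τ) + e_{ij}[-1]`. -/
noncomputable def cdetU (n : ℕ) : Polynomial (UEA n) :=
  cdet (Matrix.of fun i j : Fin n =>
    (if i = j then Polynomial.X + Polynomial.C (tauGen n) else 0)
      + Polynomial.C (eGen n i j (-1)))

/-- The matrix `u + M` over `S[u]`. -/
noncomputable def shiftX {S : Type*} [Ring S] {n : ℕ} (M : Matrix (Fin n) (Fin n) S) :
    Matrix (Fin n) (Fin n) (Polynomial S) :=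
  Matrix.of fun i j => (if i = j then Polynomial.X else 0) + Polynomial.C (M i j)

/-- The Manin relations `[a_{ij}, a_{kl}] = [a_{kj}, a_{il}]`. -/
def IsManin {ι κ R : Type*} [Ring R] (A : Matrix ι κ R) : Prop :=
  ∀ i j k l, A i j * A k l - A k l * A i j = A k j * A i l - A i l * A k j

namespace IsManin

variable {ι κ ι' κ' R : Type*} [Ring R]

theorem submatrix {A : Matrix ι κ R} (hA : IsManin A) (f : ι' → ι) (g : κ' → κ) :
    IsManin (A.submatrix f g) :=
  fun i j k l => hA (f i) (g j) (f k) (g l)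

theorem updateCol_single [DecidableEq ι] {A : Matrix ι ι R} (hA : IsManin A) (c : ι) :
    IsManin (A.updateCol c (Pi.single c 1)) := by
  intro i j k l
  have h (x : ι) (r : R) : (Pi.single c 1 : ι → R) x * r = r * (Pi.single c 1 : ι → R) x := by
    by_cases hx : x = c <;> simp [hx]
  by_cases hj : j = c
  · subst hj
    simp [Matrix.updateCol_self, h]
  · by_cases hl : l = c
    · subst hl
      simp [Matrix.updateCol_self, h]
    · simpa [Matrix.updateCol_ne, hj, hl] using hA i j k l

theorem shiftX {n : ℕ} {M : Matrix (Fin n) (Fin n) R} (hM : IsManin M) :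
    IsManin (_root_.shiftX M) := by
  intro i j k l
  have h (p q : Prop) [Decidable p] [Decidable q] (x y : R) :
      ((if p then (Polynomial.X : Polynomial R) else 0) + Polynomial.C x) *
          ((if q then Polynomial.X else 0) + Polynomial.C y) -
        ((if q then Polynomial.X else 0) + Polynomial.C y) *
          ((if p then Polynomial.X else 0) + Polynomial.C x) = Polynomial.C (x * y - y * x) := by
    have hx := Polynomial.X_mul_C x
    have hy := Polynomial.X_mul_C y
    split_ifs <;> simp only [Polynomial.C_sub, Polynomial.C_mul, zero_add, mul_add, add_mul, hx, hy]
      <;> abel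
  simp only [_root_.shiftX, Matrix.of_apply, h, hM i j k l]

end IsManin

theorem List.prod_ofFn_split {R : Type*} [Monoid R] {n : ℕ} (f : Fin (n + 1) → R) (s : Fin n) :
    (List.ofFn f).prod = ((List.ofFn f).take s).prod * (f s.castSucc * f s.succ) *
      ((List.ofFn f).drop (s + 2)).prod := by
  have h1 : (s : ℕ) < (List.ofFn f).length := by simp
  have h2 : (s : ℕ) + 1 < (List.ofFn f).length := by simp
  rw [← List.prod_take_mul_prod_drop (List.ofFn f) s, List.drop_eq_getElem_cons h1,
    List.drop_eq_getElem_cons h2]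
  simp only [List.prod_cons, List.getElem_ofFn, mul_assoc]
  rfl

theorem cdet_submatrix_swap_adjacent {R : Type*} [Ring R] {n : ℕ}
    {B : Matrix (Fin (n + 1)) (Fin (n + 1)) R} (hB : IsManin B) (s : Fin n) :
    cdet (B.submatrix id (Equiv.swap s.castSucc s.succ)) = -cdet B := by
  rw [eq_neg_iff_add_eq_zero]
  unfold cdet
  rw [← Finset.sum_add_distrib]
  have hne : s.castSucc ≠ s.succ := by simp [Fin.ext_iff]
  refine Finset.sum_involution (fun σ _ => σ * Equiv.swap s.castSucc s.succ) ?_ ?_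
    (fun _ _ => Finset.mem_univ _) ?_
  · intro σ _
    have htake (f g : Fin (n + 1) → R) (h : ∀ j, j ≠ s.castSucc → j ≠ s.succ → f j = g j) :
        (List.ofFn f).take s = (List.ofFn g).take s := by
      refine List.ext_getElem (by simp) fun i h1 h2 => ?_
      simp only [List.length_take, List.length_ofFn] at h1
      simp only [List.getElem_take, List.getElem_ofFn]
      apply h <;> simp only [ne_eq, Fin.ext_iff, Fin.val_castSucc, Fin.val_succ] <;> omega
    have hdrop (f g : Fin (n + 1) → R) (h : ∀ j, j ≠ s.castSucc → j ≠ s.succ → f j = g j) :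
        (List.ofFn f).drop (s + 2) = (List.ofFn g).drop (s + 2) := by
      refine List.ext_getElem (by simp) fun i h1 h2 => ?_
      simp only [List.getElem_drop, List.getElem_ofFn]
      apply h <;> simp only [ne_eq, Fin.ext_iff, Fin.val_castSucc, Fin.val_succ] <;> omega
    let f : Fin (n + 1) → R := fun j => B (σ j) j
    have key (g : Fin (n + 1) → R) (h : ∀ j, j ≠ s.castSucc → j ≠ s.succ → g j = f j) :
        (List.ofFn g).prod = ((List.ofFn f).take s).prod * (g s.castSucc * g s.succ) *
          ((List.ofFn f).drop (s + 2)).prod := by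
      rw [List.prod_ofFn_split g s, htake g f h, hdrop g f h]
    have hm (c : ℤ) (a b x y z w : R) (h : y - z = w - x) :
        c • (a * x * b) + c • (a * y * b) + (-c • (a * z * b) + -c • (a * w * b)) = 0 := by
      rw [sub_eq_iff_eq_add.1 h]
      simp only [mul_add, add_mul, mul_sub, sub_mul, smul_add, smul_sub, neg_smul]
      abel
    have hw (j : Fin (n + 1)) (h1 : j ≠ s.castSucc) (h2 : j ≠ s.succ) :
        Equiv.swap s.castSucc s.succ j = j := Equiv.swap_apply_of_ne_of_ne h1 h2
    rw [key (fun j => B.submatrix id (Equiv.swap s.castSucc s.succ) (σ j) j)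
        (fun j h1 h2 => by simp [f, hw j h1 h2]),
      key (fun j => B (σ j) j) (fun j _ _ => rfl),
      key (fun j => B.submatrix id (Equiv.swap s.castSucc s.succ)
        ((σ * Equiv.swap s.castSucc s.succ) j) j) (fun j h1 h2 => by simp [f, hw j h1 h2]),
      key (fun j => B ((σ * Equiv.swap s.castSucc s.succ) j) j)
        (fun j h1 h2 => by simp [f, hw j h1 h2])]
    have hsgn : ((Equiv.Perm.sign (σ * Equiv.swap s.castSucc s.succ) : ℤˣ) : ℤ) =
        -(Equiv.Perm.sign σ : ℤ) := by
      rw [Equiv.Perm.sign_mul, Equiv.Perm.sign_swap hne]; simp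
    rw [hsgn]
    simp only [Matrix.submatrix_apply, id, Equiv.Perm.mul_apply, Equiv.swap_apply_left,
      Equiv.swap_apply_right]
    exact hm _ _ _ _ _ _ _ (hB (σ s.castSucc) s.castSucc (σ s.succ) s.succ)
  · intro σ _ _ h
    have := DFunLike.congr_fun h s.castSucc
    simp only [Equiv.Perm.mul_apply, Equiv.swap_apply_left] at this
    exact hne (σ.injective this).symm
  · intro σ _
    simp [mul_assoc]

theorem cdet_submatrix_perm {R : Type*} [Ring R] {n : ℕ} (π : Equiv.Perm (Fin (n + 1)))
    {B : Matrix (Fin (n + 1)) (Fin (n + 1)) R} (hB : IsManin B) :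
    cdet (B.submatrix id π) = (Equiv.Perm.sign π : ℤ) • cdet B := by
  have hπ : π ∈ Submonoid.closure
      (Set.range fun i : Fin n => Equiv.swap i.castSucc i.succ) := by
    rw [Equiv.Perm.mclosure_swap_castSucc_succ]; trivial
  induction hπ using Submonoid.closure_induction generalizing B with
  | mem x hx =>
    obtain ⟨s, rfl⟩ := hx
    have hne : s.castSucc ≠ s.succ := by simp [Fin.ext_iff]
    simp [cdet_submatrix_swap_adjacent hB s, Equiv.Perm.sign_swap hne]
  | one => simp
  | mul x y _ _ hx hy =>
    have : B.submatrix id (x * y : Equiv.Perm (Fin (n + 1))) =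
        (B.submatrix id x).submatrix id y := by
      ext; simp
    rw [this, hy (hB.submatrix id x), hx hB, smul_smul, Equiv.Perm.sign_mul, Units.val_mul,
      mul_comm]

theorem cdet_eq_zero_of_col_eq {R : Type*} [Ring R] [Algebra ℂ R] {n : ℕ}
    {B : Matrix (Fin (n + 1)) (Fin (n + 1)) R} (hB : IsManin B) {j l : Fin (n + 1)}
    (hjl : j ≠ l) (h : ∀ i, B i j = B i l) : cdet B = 0 := by
  have h1 := cdet_submatrix_perm (Equiv.swap j l) hB
  have h2 : B.submatrix id (Equiv.swap j l) = B := by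
    ext i k
    simp only [Matrix.submatrix_apply, id]
    by_cases hk : k = j
    · subst hk; simp [h]
    · by_cases hk' : k = l
      · subst hk'; simp [h]
      · rw [Equiv.swap_apply_of_ne_of_ne hk hk']
  rw [h2, Equiv.Perm.sign_swap hjl] at h1
  have h3 : cdet B + cdet B = 0 := by
    rw [← eq_neg_iff_add_eq_zero]
    simpa using h1
  have h4 : (2 : ℂ) • cdet B = 0 := by rw [two_smul, h3]
  simpa using h4

/-- The permutation sending the last index to `j` and the remaining ones to the complement of `j`
through `e`. -/
def Fin.permOfLast {n : ℕ} (j : Fin (n + 1)) (e : Equiv.Perm (Fin n)) :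
    Equiv.Perm (Fin (n + 1)) :=
  j.cycleRange.symm * Equiv.Perm.decomposeFin.symm (0, e) * finRotate (n + 1)

@[simp]
theorem Fin.permOfLast_last {n : ℕ} (j : Fin (n + 1)) (e : Equiv.Perm (Fin n)) :
    Fin.permOfLast j e (Fin.last n) = j := by
  simp [Fin.permOfLast]

@[simp]
theorem Fin.permOfLast_castSucc {n : ℕ} (j : Fin (n + 1)) (e : Equiv.Perm (Fin n)) (x : Fin n) :
    Fin.permOfLast j e x.castSucc = j.succAbove (e x) := by
  have : finRotate (n + 1) x.castSucc = x.succ := by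
    rw [finRotate_apply, Fin.coeSucc_eq_succ]
  simp [Fin.permOfLast, this, -finRotate_apply]

theorem Fin.sign_permOfLast {n : ℕ} (j : Fin (n + 1)) (e : Equiv.Perm (Fin n)) :
    (Equiv.Perm.sign (Fin.permOfLast j e) : ℤ) = (-1) ^ (n + j : ℕ) * Equiv.Perm.sign e := by
  have : Equiv.Perm.sign j.cycleRange.symm = (-1) ^ (j : ℕ) := by
    rw [Equiv.Perm.sign_symm, Fin.sign_cycleRange]
  simp [Fin.permOfLast, Equiv.Perm.sign_mul, this, sign_finRotate,
    Equiv.Perm.decomposeFin.symm_sign]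
  ring

theorem Fin.permOfLast_bijective (n : ℕ) :
    Function.Bijective fun p : Fin (n + 1) × Equiv.Perm (Fin n) => Fin.permOfLast p.1 p.2 := by
  rw [Fintype.bijective_iff_injective_and_card]
  constructor
  · rintro ⟨j, e⟩ ⟨j', e'⟩ h
    have hj : j = j' := by simpa using DFunLike.congr_fun h (Fin.last n)
    subst hj
    congr 1
    ext x
    have := DFunLike.congr_fun h x.castSucc
    simp only [Fin.permOfLast_castSucc] at this
    rw [Fin.succAbove_right_injective this]
  · simp [Fintype.card_perm, Nat.factorial_succ]

theorem cdet_succ_column_last {R : Type*} [Ring R] {n : ℕ}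
    (B : Matrix (Fin (n + 1)) (Fin (n + 1)) R) :
    cdet B = ∑ j : Fin (n + 1), (-1 : ℤ) ^ (n + j : ℕ) •
      (cdet (B.submatrix j.succAbove Fin.castSucc) * B j (Fin.last n)) := by
  unfold cdet
  rw [← (Fin.permOfLast_bijective n).sum_comp, Fintype.sum_prod_type]
  refine Finset.sum_congr rfl fun j _ => ?_
  rw [Finset.sum_mul, Finset.smul_sum]
  refine Finset.sum_congr rfl fun e _ => ?_
  rw [Fin.sign_permOfLast, smul_mul_assoc, smul_smul, List.ofFn_succ', List.concat_eq_append,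
    List.prod_append]
  simp

theorem sum_cofactor_mul {R : Type*} [Ring R] [Algebra ℂ R] {n : ℕ}
    {B : Matrix (Fin (n + 1)) (Fin (n + 1)) R} (hB : IsManin B) (i k : Fin (n + 1)) :
    ∑ j : Fin (n + 1), (-1 : ℤ) ^ (i + j : ℕ) •
      (cdet (B.submatrix j.succAbove i.succAbove) * B j k) =
      if i = k then cdet B else 0 := by
  let c : Fin (n + 1) → Fin (n + 1) := Fin.snoc i.succAbove k
  have hc := cdet_succ_column_last (B.submatrix id c)
  have hsum : ∑ j : Fin (n + 1), (-1 : ℤ) ^ (i + j : ℕ) •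
      (cdet (B.submatrix j.succAbove i.succAbove) * B j k) =
        (-1 : ℤ) ^ (n + i : ℕ) • cdet (B.submatrix id c) := by
    rw [hc, Finset.smul_sum]
    refine Finset.sum_congr rfl fun j _ => ?_
    have h1 : (B.submatrix id c).submatrix j.succAbove Fin.castSucc =
        B.submatrix j.succAbove i.succAbove := by
      ext x y; simp [c]
    have h2 : (-1 : ℤ) ^ (n + i : ℕ) * (-1) ^ (n + j : ℕ) = (-1) ^ (i + j : ℕ) := by
      rw [← pow_add, show n + (i : ℕ) + (n + j) = 2 * n + (i + j) by ring, pow_add, pow_mul]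
      simp
    rw [h1, smul_smul, h2]
    simp [c]
  rw [hsum]
  split_ifs with h
  · subst h
    have hp : c = Fin.permOfLast i 1 := by
      funext x
      refine Fin.lastCases ?_ (fun y => ?_) x <;> simp [c]
    rw [hp, cdet_submatrix_perm _ hB, Fin.sign_permOfLast, smul_smul]
    simp [← pow_add, ← two_mul]
  · obtain ⟨y, hy⟩ := Fin.exists_succAbove_eq (Ne.symm h)
    rw [cdet_eq_zero_of_col_eq (hB.submatrix id c) (Fin.castSucc_lt_last y).ne, smul_zero]
    intro x
    simp [c, hy]

theorem Polynomial.derivative_prod_ofFn {R : Type*} [Ring R] {n : ℕ}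
    (f : Fin n → Polynomial R) :
    derivative (List.ofFn f).prod =
      ∑ i, (List.ofFn (Function.update f i (derivative (f i)))).prod := by
  induction n with
  | zero => simp
  | succ n ih =>
    have h (i : Fin n) (x : Polynomial R) : (fun y : Fin n => Function.update f i.succ x y.succ) =
        Function.update (fun y : Fin n => f y.succ) i x := Fin.tail_update_succ f i x
    simp [List.ofFn_succ, Polynomial.derivative_mul, ih, Fin.sum_univ_succ, Finset.mul_sum, h,
      Function.update_of_ne (Fin.succ_ne_zero _).symm]

section CharPoly

variable {S : Type*} [Ring S] {n : ℕ}

theorem derivative_cdet_shiftX [Algebra ℂ S]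
    {M : Matrix (Fin (n + 1)) (Fin (n + 1)) S} (hM : IsManin M) :
    Polynomial.derivative (cdet (shiftX M)) =
      ∑ i : Fin (n + 1), cdet ((shiftX M).submatrix i.succAbove i.succAbove) := by
  have h1 : Polynomial.derivative (cdet (shiftX M)) =
      ∑ i, cdet ((shiftX M).updateCol i (Pi.single i 1)) := by
    unfold cdet
    rw [Finset.sum_comm, Polynomial.derivative_sum]
    refine Finset.sum_congr rfl fun σ _ => ?_
    rw [Polynomial.derivative_smul, Polynomial.derivative_prod_ofFn, Finset.smul_sum]
    refine Finset.sum_congr rfl fun i _ => ?_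
    congr 3
    funext j
    by_cases hj : j = i
    · subst hj
      by_cases h : σ j = j <;> simp [shiftX, h, Matrix.updateCol_self]
    · simp [Matrix.updateCol_ne, hj]
  rw [h1]
  refine Finset.sum_congr rfl fun i _ => ?_
  have h2 := sum_cofactor_mul (IsManin.updateCol_single (A := shiftX M) hM.shiftX i) i i
  rw [if_pos rfl] at h2
  rw [← h2, Finset.sum_eq_single i]
  · have : ((shiftX M).updateCol i (Pi.single i 1)).submatrix i.succAbove i.succAbove =
        (shiftX M).submatrix i.succAbove i.succAbove := by
      ext1 x y
      simp [Matrix.updateCol_ne]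
    rw [this]
    simp [Matrix.updateCol_self, ← two_mul]
  · intro j _ hj
    simp [Matrix.updateCol_self, hj]
  · simp

theorem natDegree_cdet_le {B : Matrix (Fin n) (Fin n) (Polynomial S)}
    (hB : ∀ i j, (B i j).natDegree ≤ 1) : (cdet B).natDegree ≤ n := by
  refine Polynomial.natDegree_sum_le_of_forall_le _ _ fun σ _ => ?_
  refine (Polynomial.natDegree_smul_le _ _).trans ((Polynomial.natDegree_list_prod_le _).trans ?_)
  refine (List.sum_le_card_nsmul _ 1 ?_).trans (by simp)
  simp [List.mem_ofFn, hB]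

theorem natDegree_shiftX_le (M : Matrix (Fin n) (Fin n) S) (i j : Fin n) :
    (shiftX M i j).natDegree ≤ 1 := by
  by_cases h : i = j
  · simpa [shiftX, h] using Polynomial.natDegree_X_le
  · simp [shiftX, h]

/-- The coefficient of `u^m`, as a matrix over `S`, of the cofactor matrix of `u + M`. -/
noncomputable def cofactorCoeff (M : Matrix (Fin (n + 1)) (Fin (n + 1)) S) (m : ℕ) :
    Matrix (Fin (n + 1)) (Fin (n + 1)) S :=
  Matrix.of fun i j => (-1 : ℤ) ^ (i + j : ℕ) •
    (cdet ((shiftX M).submatrix j.succAbove i.succAbove)).coeff m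

theorem cofactorCoeff_eq_zero (M : Matrix (Fin (n + 1)) (Fin (n + 1)) S) {m : ℕ} (hm : n < m) :
    cofactorCoeff M m = 0 := by
  ext i j
  have : (cdet ((shiftX M).submatrix j.succAbove i.succAbove)).coeff m = 0 :=
    Polynomial.coeff_eq_zero_of_natDegree_lt
      ((natDegree_cdet_le fun _ _ => natDegree_shiftX_le M _ _).trans_lt hm)
  simp [cofactorCoeff, this]

theorem cofactorCoeff_zero_mul [Algebra ℂ S]
    {M : Matrix (Fin (n + 1)) (Fin (n + 1)) S} (hM : IsManin M) :
    cofactorCoeff M 0 * M = (cdet (shiftX M)).coeff 0 • 1 := by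
  ext i k
  have h := congrArg (Polynomial.coeff · 0)
    (sum_cofactor_mul (B := shiftX M) hM.shiftX i k)
  simp only [Polynomial.finsetSum_coeff, Polynomial.coeff_smul] at h
  rw [Matrix.mul_apply, Matrix.smul_apply, Matrix.one_apply, smul_eq_mul, mul_ite, mul_one,
    mul_zero]
  trans (if i = k then cdet (shiftX M) else 0).coeff 0
  · rw [← h]
    refine Finset.sum_congr rfl fun j _ => ?_
    by_cases hjk : j = k <;> simp [cofactorCoeff, shiftX, hjk, mul_add, mul_assoc]
  · split_ifs <;> simp

theorem cofactorCoeff_add_mul [Algebra ℂ S]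
    {M : Matrix (Fin (n + 1)) (Fin (n + 1)) S} (hM : IsManin M)
    (m : ℕ) :
    cofactorCoeff M m + cofactorCoeff M (m + 1) * M = (cdet (shiftX M)).coeff (m + 1) • 1 := by
  ext i k
  have h := congrArg (Polynomial.coeff · (m + 1))
    (sum_cofactor_mul (B := shiftX M) hM.shiftX i k)
  simp only [Polynomial.finsetSum_coeff, Polynomial.coeff_smul] at h
  rw [Matrix.add_apply, Matrix.mul_apply, Matrix.smul_apply, Matrix.one_apply, smul_eq_mul,
    mul_ite, mul_one, mul_zero]
  trans (if i = k then cdet (shiftX M) else 0).coeff (m + 1)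
  · rw [← h]
    have h1 : cofactorCoeff M m i k = ∑ j, if j = k then cofactorCoeff M m i j else 0 := by simp
    rw [h1, ← Finset.sum_add_distrib]
    refine Finset.sum_congr rfl fun j _ => ?_
    by_cases hjk : j = k <;> simp [cofactorCoeff, shiftX, hjk, mul_add, mul_assoc]
  · split_ifs <;> simp

theorem cofactorCoeff_eq_sum [Algebra ℂ S]
    {M : Matrix (Fin (n + 1)) (Fin (n + 1)) S} (hM : IsManin M)
    (m : ℤ) :
    (if 0 ≤ m then cofactorCoeff M m.toNat else 0) =
      ∑ a ∈ Finset.range (n + 1 + 1), if m + 1 ≤ (a : ℤ) then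
        (cdet (shiftX M)).coeff a • (((-1 : ℤ) ^ ((a : ℤ) - m - 1).toNat) •
          M ^ ((a : ℤ) - m - 1).toNat) else 0 := by
  by_cases hm : (n : ℤ) + 1 ≤ m
  · rw [if_pos (by omega), cofactorCoeff_eq_zero M (by omega)]
    refine (Finset.sum_eq_zero fun a ha => if_neg ?_).symm
    rw [Finset.mem_range] at ha
    omega
  · have hrec : (if 0 ≤ m then cofactorCoeff M m.toNat else 0) =
        (if 0 ≤ m + 1 then (cdet (shiftX M)).coeff (m + 1).toNat • 1 else 0) -
          (if 0 ≤ m + 1 then cofactorCoeff M (m + 1).toNat else 0) * M := by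
      rcases lt_trichotomy m (-1) with h | h | h
      · simp [show ¬ 0 ≤ m by omega, show ¬ 0 ≤ m + 1 by omega]
      · subst h
        simp [cofactorCoeff_zero_mul hM]
      · obtain ⟨k, rfl⟩ := Int.eq_ofNat_of_zero_le (show 0 ≤ m by omega)
        have := cofactorCoeff_add_mul hM k
        rw [if_pos (by omega), if_pos (by omega), if_pos (by omega)]
        exact eq_sub_of_add_eq this
    have hfirst : (if 0 ≤ m + 1 then (cdet (shiftX M)).coeff (m + 1).toNat • 1 else 0) =
        ∑ a ∈ Finset.range (n + 1 + 1), if m + 1 = (a : ℤ) then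
          (cdet (shiftX M)).coeff a • (1 : Matrix (Fin (n + 1)) (Fin (n + 1)) S) else 0 := by
      split_ifs with h
      · obtain ⟨k, hk⟩ := Int.eq_ofNat_of_zero_le h
        simp only [hk, Nat.cast_inj]
        rw [Finset.sum_ite_eq, if_pos (by rw [Finset.mem_range]; omega)]
        simp
      · exact (Finset.sum_eq_zero fun a _ => if_neg (by omega)).symm
    rw [hrec, hfirst, cofactorCoeff_eq_sum hM (m + 1), Finset.sum_mul, ← Finset.sum_sub_distrib]
    refine Finset.sum_congr rfl fun a _ => ?_
    rcases lt_trichotomy (m + 1) (a : ℤ) with h | h | h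
    · rw [if_neg (by omega), if_pos (by omega), if_pos (by omega),
        show ((a : ℤ) - m - 1).toNat = ((a : ℤ) - (m + 1) - 1).toNat + 1 by omega]
      simp [pow_succ, smul_mul_assoc, mul_assoc]
    · rw [if_pos h, if_neg (by omega), if_pos (by omega),
        show ((a : ℤ) - m - 1).toNat = 0 by omega]
      simp
    · rw [if_neg (by omega), if_neg (by omega), if_neg (by omega)]
      simp
termination_by ((n : ℤ) + 1 - m).toNat

/-- The Newton identity for a Manin matrix. -/
theorem newton_identity_of_isManin [Algebra ℂ S]
    {M : Matrix (Fin (n + 1)) (Fin (n + 1)) S} (hM : IsManin M)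
    (m : ℤ) :
    (if 0 ≤ m then (Polynomial.derivative (cdet (shiftX M))).coeff m.toNat else 0) =
      ∑ a ∈ Finset.range (n + 1 + 1), if m + 1 ≤ (a : ℤ) then
        (cdet (shiftX M)).coeff a * (((-1 : ℤ) ^ ((a : ℤ) - m - 1).toNat) •
          Matrix.trace (M ^ ((a : ℤ) - m - 1).toNat)) else 0 := by
  have h := congrArg Matrix.trace (cofactorCoeff_eq_sum hM m)
  rw [Matrix.trace_sum] at h
  convert h using 1
  · split_ifs
    · rw [derivative_cdet_shiftX hM, Polynomial.finsetSum_coeff]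
      simp [Matrix.trace, cofactorCoeff, ← two_mul]
    · simp
  · refine Finset.sum_congr rfl fun a _ => ?_
    split_ifs
    · rw [Matrix.trace_smul, Matrix.trace_smul, smul_eq_mul]
    · simp

end CharPoly

theorem tauGen_mul_eGen (n : ℕ) (i j : Fin n) :
    tauGen n * eGen n i j (-1) = eGen n i j (-1) * tauGen n + eGen n i j (-2) := by
  have h := RingQuot.mkAlgHom_rel ℂ (AffRel.TE i j (-1))
  simp only [map_sub, map_mul, map_smul] at h
  rw [sub_eq_iff_eq_add] at h
  simpa [add_comm, tauGen, eGen] using h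

theorem eGen_mul_eGen (n : ℕ) (i j k l : Fin n) :
    eGen n i j (-1) * eGen n k l (-1) = eGen n k l (-1) * eGen n i j (-1) +
      ((if k = j then eGen n i l (-2) else 0) - if i = l then eGen n k j (-2) else 0) := by
  have h := RingQuot.mkAlgHom_rel ℂ (AffRel.EE i j k l (-1) (-1))
  rw [if_neg (show ¬ (-1 : ℤ) = -(-1) by decide), mul_zero, zero_mul, zero_smul, add_zero] at h
  simp only [map_sub, map_mul, apply_ite (RingQuot.mkAlgHom ℂ (AffRel n)), map_zero] at h
  rw [sub_eq_iff_eq_add, add_comm] at h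
  exact h

theorem isManin_tauE (n : ℕ) : IsManin (tauE n) := by
  intro i j k l
  have ht := tauGen_mul_eGen n
  have he := eGen_mul_eGen n
  have h (i j k l : Fin n) : tauE n i j * tauE n k l - tauE n k l * tauE n i j =
      (if i = j then eGen n k l (-2) else 0) - (if k = l then eGen n i j (-2) else 0) +
      ((if k = j then eGen n i l (-2) else 0) - if i = l then eGen n k j (-2) else 0) := by
    simp only [tauE, Matrix.of_apply, add_mul, mul_add, he i j k l]
    by_cases h1 : i = j <;> by_cases h2 : k = l <;> simp only [h1, h2, if_true, if_false, ht,
      zero_mul, mul_zero] <;> abel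
  rw [h, h]
  abel

theorem cdetU_eq (n : ℕ) : cdetU n = cdet (shiftX (tauE n)) := by
  unfold cdetU
  congr 1
  ext1 i j
  by_cases h : i = j <;> simp [shiftX, tauE, h, add_assoc]

/-- the identity
`∂_u cdet(u + τ + E[-1]) = cdet(u + τ + E[-1]) · Σ_{k≥0} (-1)^k u^{-k-1} tr((τ + E[-1])^k)`
holds in `U[u][[u^{-1}]]`, i.e. the coefficients of `u^m` on both sides agree for
every `m : ℤ`.  On the left the coefficient of `u^m` is `(∂_u P).coeff m` (zero
for `m < 0`); on the right it is `Σ_{a} P.coeff a · (-1)^{a-m-1} tr((τ+E[-1])^{a-m-1})`,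
the sum over `0 ≤ a ≤ n` with `a ≥ m + 1` (as `P` has degree `n`). -/
theorem newton_liouville_identity (n : ℕ) (hn : 1 ≤ n) :
    ∀ m : ℤ,
      (if 0 ≤ m then (Polynomial.derivative (cdetU n)).coeff m.toNat else 0)
        = ∑ a ∈ Finset.range (n + 1),
            if m + 1 ≤ (a : ℤ) then
              (cdetU n).coeff a *
                (((-1 : ℤ) ^ ((a : ℤ) - m - 1).toNat) •
                  Matrix.trace (tauE n ^ ((a : ℤ) - m - 1).toNat))
            else 0 := by
  obtain ⟨n, rfl⟩ := Nat.exists_eq_add_of_le' hn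
  intro m
  rw [cdetU_eq]
  exact newton_identity_of_isManin (isManin_tauE (n + 1)) m
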